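/- Let P be a general program in which every atom of B occurs, and let P' = P ∪ {a ← a | a occurs in P}, where a ← a denotes the rule with head {a} and body the generalized atom whose models are exactly the interpretations containing a. Then the FLP answer sets and the SFLP answer sets of P' coincide: FLP(P') = SFLP(P'). -/

import Mathlib

/-- A general rule: a finite set of atoms as (disjunctive) head,
and a generalized atom as body, given with its finite domain `dom`. -/
structure GRule (B : Type*) where
  head : Finset B
  dom : Finset B
  body : Set B → Prop

variable {B : Type*}

/-- `I ⊨ r`. -/
def satRule (I : Set B) (r : GRule B) : Prop :=
  r.body I → (I ∩ ↑r.head).Nonempty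

/-- `I ⊨ P`. -/
def satProg (I : Set B) (P : Set (GRule B)) : Prop :=
  ∀ r ∈ P, satRule I r

/-- The FLP reduct `P^I`. -/
def reduct (P : Set (GRule B)) (I : Set B) : Set (GRule B) :=
  {r ∈ P | r.body I}

/-- `I ⊨_s P`: `I` is a supported model of `P`. -/
def suppModel (I : Set B) (P : Set (GRule B)) : Prop :=
  satProg I P ∧ ∀ a ∈ I, ∃ r ∈ P, r.body I ∧ I ∩ ↑r.head = {a}

/-- `I` is an FLP answer set of `P`. -/
def isFLP (I : Set B) (P : Set (GRule B)) : Prop :=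
  satProg I P ∧ ∀ J : Set B, J ⊂ I → ¬ satProg J (reduct P I)

/-- `I` is an SFLP answer set of `P`. -/
def isSFLP (I : Set B) (P : Set (GRule B)) : Prop :=
  suppModel I P ∧ ∀ J : Set B, J ⊂ I → ¬ suppModel J (reduct P I)

/-- An atom occurs in P if it is in the head or in the domain of the body
of some rule of P. -/
def occurs (a : B) (P : Set (GRule B)) : Prop :=
  ∃ r ∈ P, a ∈ r.head ∨ a ∈ r.dom

/-- The rule `a ← a`: head {a}, body the generalized atom whose models are
exactly the interpretations containing a. -/
def selfRule (a : B) : GRule B :=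
  ⟨{a}, {a}, fun I => a ∈ I⟩

/-- `P' = P ∪ {a ← a | a occurs in P}`. -/
def addSelf (P : Set (GRule B)) : Set (GRule B) :=
  P ∪ {r | ∃ a : B, occurs a P ∧ r = selfRule a}

/-- if every atom of B occurs in P, then for
P' = P ∪ {a ← a | a occurs in P} one has FLP(P') = SFLP(P'). -/
theorem stmt9 {B : Type*} (P : Set (GRule B)) (hocc : ∀ a : B, occurs a P) :
    {I : Set B | isFLP I (addSelf P)} = {I : Set B | isSFLP I (addSelf P)} := by
  have key : ∀ I : Set B, ∀ a ∈ I, I ∩ ↑(selfRule a).head = {a} := by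
    intro I a ha
    ext x
    simp only [selfRule, Finset.coe_singleton, Set.mem_inter_iff, Set.mem_singleton_iff]
    constructor
    · exact fun h => h.2
    · rintro rfl
      exact ⟨ha, rfl⟩
  have mem : ∀ a : B, selfRule a ∈ addSelf P := fun a => Or.inr ⟨a, hocc a, rfl⟩
  have h1 : ∀ I : Set B, suppModel I (addSelf P) ↔ satProg I (addSelf P) := fun I =>
    ⟨fun h => h.1, fun h => ⟨h, fun a ha => ⟨selfRule a, mem a, ha, key I a ha⟩⟩⟩
  have h2 : ∀ I J : Set B, J ⊂ I →
      (suppModel J (reduct (addSelf P) I) ↔ satProg J (reduct (addSelf P) I)) := fun I J hJ =>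
    ⟨fun h => h.1, fun h => ⟨h, fun a ha =>
      ⟨selfRule a, ⟨mem a, hJ.1 ha⟩, ha, key J a ha⟩⟩⟩
  ext I
  constructor
  · rintro ⟨h, h'⟩
    exact ⟨(h1 I).2 h, fun J hJ hs => h' J hJ hs.1⟩
  · rintro ⟨h, h'⟩
    exact ⟨h.1, fun J hJ hs => h' J hJ ((h2 I J hJ).2 hs)⟩
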